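/- Let S be a proper dyadic subbase of X. Then the partial surjection ρ'_S from 2^ω onto X is an admissible representation of X if and only if S_{n,⊥} = ∅ for every n ∈ ℕ. (Proposition 3.2) -/

import Mathlib

open Set Topology TopologicalSpace

/-- The three-element set 𝕋 = {0, 1, ⊥}. `digit b` is a digit (0 or 1), `bot` is ⊥. -/
inductive TT where
  | bot : TT
  | digit : Bool → TT
  deriving DecidableEq

/-- The topology on 𝕋 whose open sets are ∅, {0}, {1}, {0,1}, 𝕋. -/
instance : TopologicalSpace TT :=
  generateFrom {{TT.digit false}, {TT.digit true}}

/-- The pointwise order ⊑ on 𝕋^ω (⊥ ⊑ 0, ⊥ ⊑ 1, digits incomparable). -/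
def TLe (p q : ℕ → TT) : Prop := ∀ k (b : Bool), p k = TT.digit b → q k = TT.digit b

/-- Compatibility in 𝕋^ω: existence of a common upper bound. -/
def TCompat (p q : ℕ → TT) : Prop := ∃ r, TLe p r ∧ TLe q r

/-- dom(p) = the set of positions where p has a digit. -/
def Tdom (p : ℕ → TT) : Set ℕ := {k | p k ≠ TT.bot}

/-- p is a finite bottomed sequence (an element of 𝕋^*). -/
def TFin (p : ℕ → TT) : Prop := (Tdom p).Finite

/-- The truncation p|_n. -/
def trunc (p : ℕ → TT) (n : ℕ) : ℕ → TT := fun k => if k < n then p k else TT.bot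

/-- The pointwise least upper bound of two (compatible) bottomed sequences. -/
def tsup (d e : ℕ → TT) : ℕ → TT := fun k => if d k = TT.bot then e k else d k

/-- A dyadic subbase of X: a family of regular open sets, pairwise exteriors,
forming a subbase of the topology of X. -/
structure DyadicSubbase (X : Type*) [t : TopologicalSpace X] where
  S : ℕ → Bool → Set X
  regOpen : ∀ n a, S n a = interior (closure (S n a))
  compl : ∀ n, S n true = (closure (S n false))ᶜ
  subbase : generateFrom {U | ∃ n a, U = S n a} = t

variable {X : Type*} [TopologicalSpace X]

open Classical in
/-- The embedding φ_S : X → 𝕋^ω. -/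
noncomputable def phi (D : DyadicSubbase X) (x : X) : ℕ → TT := fun n =>
  if x ∈ D.S n false then TT.digit false
  else if x ∈ D.S n true then TT.digit true
  else TT.bot

/-- S(p) = ⋂_{k ∈ dom p} S_{k, p(k)}. -/
def Sint (D : DyadicSubbase X) (p : ℕ → TT) : Set X :=
  {x | ∀ k (b : Bool), p k = TT.digit b → x ∈ D.S k b}

/-- S̄(p) = ⋂_{k ∈ dom p} cl(S_{k, p(k)}). -/
def SbarInt (D : DyadicSubbase X) (p : ℕ → TT) : Set X :=
  {x | ∀ k (b : Bool), p k = TT.digit b → x ∈ closure (D.S k b)}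

/-- S is a proper dyadic subbase: cl(S(e)) = S̄(e) for all finite bottomed e. -/
def IsProperDS (D : DyadicSubbase X) : Prop :=
  ∀ e, TFin e → closure (Sint D e) = SbarInt D e

/-- ↑X̃ = {p : x̃ ⊑ p for some x}. -/
def upX (D : DyadicSubbase X) : Set (ℕ → TT) := {p | ∃ x, TLe (phi D x) p}

/-- 2^ω, the bottom-free sequences. -/
def twoOmega : Set (ℕ → TT) := {p | ∀ k, p k ≠ TT.bot}

/-- K_S = {x̃|_m : x ∈ X, m ∈ ℕ}. -/
def KS (D : DyadicSubbase X) : Set (ℕ → TT) := {e | ∃ x m, e = trunc (phi D x) m}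

/-- K̂_S = {p|_m : p ∈ ↑X̃, m ∈ ℕ}. -/
def KhatS (D : DyadicSubbase X) : Set (ℕ → TT) := {e | ∃ p ∈ upX D, ∃ m, e = trunc p m}

/-- I is an ideal of the subposet K of 𝕋^ω. -/
def IsIdealOf (K I : Set (ℕ → TT)) : Prop :=
  I ⊆ K ∧ I.Nonempty ∧ (∀ d ∈ I, ∀ e ∈ I, ∃ f ∈ I, TLe d f ∧ TLe e f) ∧
    (∀ d ∈ K, ∀ e ∈ I, TLe d e → d ∈ I)

/-- p is the pointwise least upper bound of the set I in 𝕋^ω. -/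
def IsSupOf (I : Set (ℕ → TT)) (p : ℕ → TT) : Prop :=
  ∀ k (b : Bool), p k = TT.digit b ↔ ∃ e ∈ I, e k = TT.digit b

/-- D_S ⊆ 𝕋^ω: least upper bounds of ideals of K_S. -/
def DS (D : DyadicSubbase X) : Set (ℕ → TT) := {p | ∃ I, IsIdealOf (KS D) I ∧ IsSupOf I p}

/-- D̂_S ⊆ 𝕋^ω: least upper bounds of ideals of K̂_S. -/
def DhatS (D : DyadicSubbase X) : Set (ℕ → TT) := {p | ∃ I, IsIdealOf (KhatS D) I ∧ IsSupOf I p}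

/-- The limit (non-compact) elements of a subdomain E of 𝕋^ω:
those with infinite domain. -/
def limitsOf (E : Set (ℕ → TT)) : Set (ℕ → TT) := {p ∈ E | (Tdom p).Infinite}

/-- The minimal elements of a subset A of 𝕋^ω. -/
def minOf (A : Set (ℕ → TT)) : Set (ℕ → TT) := {p ∈ A | ∀ q ∈ A, TLe q p → q = p}

/-- q is an immediate successor of p in the subposet K of 𝕋^ω. -/
def ImmSucc (K : Set (ℕ → TT)) (p q : ℕ → TT) : Prop :=
  p ∈ K ∧ q ∈ K ∧ TLe p q ∧ p ≠ q ∧ ¬∃ r ∈ K, TLe p r ∧ p ≠ r ∧ TLe r q ∧ r ≠ q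

/-- A Hausdorff space is adhesive if it has at least two points and the closures
of any two nonempty open sets intersect. -/
def Adhesive (Y : Type*) [TopologicalSpace Y] : Prop :=
  (∃ y z : Y, y ≠ z) ∧
    ∀ U V : Set Y, IsOpen U → IsOpen V → U.Nonempty → V.Nonempty →
      (closure U ∩ closure V).Nonempty

/-- A space is strongly nonadhesive if every open subspace is nonadhesive. -/
def StronglyNonadhesive (Y : Type*) [TopologicalSpace Y] : Prop :=
  ∀ U : Set Y, IsOpen U → ¬ Adhesive U
theorem aux_phi (D : DyadicSubbase X) (x : X) (k : ℕ) (b : Bool) :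
    phi D x k = TT.digit b ↔ x ∈ D.S k b := by
  have h : x ∈ D.S k true → x ∉ D.S k false := by
    intro h1 h2
    rw [D.compl] at h1
    exact h1 (subset_closure h2)
  unfold phi
  cases b <;> split_ifs <;> simp_all

theorem aux_openS (D : DyadicSubbase X) (k : ℕ) (b : Bool) : IsOpen (D.S k b) := by
  rw [D.regOpen]; exact isOpen_interior

theorem aux_openT (b : Bool) : IsOpen ({TT.digit b} : Set TT) := by
  apply isOpen_generateFrom_of_mem
  cases b <;> simp

theorem aux_openP (k : ℕ) (b : Bool) : IsOpen {p : ℕ → TT | p k = TT.digit b} :=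
  (aux_openT b).preimage (continuous_apply (A := fun _ : ℕ => TT) k)

theorem aux_cont_phi (D : DyadicSubbase X) : Continuous (phi D) := by
  refine continuous_pi fun k => continuous_generateFrom_iff.2 ?_
  rintro s hs
  have : ∃ b, s = {TT.digit b} := by
    rcases hs with h | h
    · exact ⟨_, h⟩
    · exact ⟨_, h⟩
  obtain ⟨b, rfl⟩ := this
  convert aux_openS D k b using 1
  ext x
  simp [aux_phi]

theorem aux_cont {Y : Type*} [TopologicalSpace Y] (D : DyadicSubbase X) (g : Y → X)
    (h : ∀ k b, IsOpen (g ⁻¹' D.S k b)) : Continuous g := by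
  have h2 := D.subbase
  have : @Continuous Y X _ (generateFrom {U | ∃ n a, U = D.S n a}) g := by
    refine continuous_generateFrom_iff.2 ?_
    rintro s ⟨n, a, rfl⟩
    exact h n a
  rwa [h2] at this

theorem aux_sep [T2Space X] (D : DyadicSubbase X) (x y : X)
    (h : ∀ k b, x ∈ D.S k b ↔ y ∈ D.S k b) : x = y := by
  have hi : IsInducing (phi D) := by
    refine ⟨le_antisymm (aux_cont_phi D).le_induced ?_⟩
    nth_rw 2 [← D.subbase]
    refine le_generateFrom ?_
    rintro s ⟨n, a, rfl⟩
    refine ⟨_, aux_openP n a, ?_⟩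
    ext z
    simp [aux_phi]
  refine hi.injective ?_
  funext k
  cases hx : phi D x k with
  | digit b => rw [aux_phi, h, ← aux_phi] at hx; exact hx.symm
  | bot =>
    cases hy : phi D y k with
    | bot => rfl
    | digit b => rw [aux_phi, ← h, ← aux_phi, hx] at hy; cases hy

theorem aux_fwd [T2Space X] (D : DyadicSubbase X)
    (ρ : (ℕ → TT) → X) (hρ : ∀ p ∈ upX D, SbarInt D p = {ρ p})
    (H : ∀ A : Set (ℕ → TT), A ⊆ twoOmega → ∀ γ : A → X, Continuous γ →
        ∃ f : A → (ℕ → TT), Continuous f ∧ (∀ a, f a ∈ upX D ∩ twoOmega) ∧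
          ∀ a, γ a = ρ (f a)) (n : ℕ) (x : X) : ∃ b, x ∈ D.S n b := by
  classical
  obtain ⟨e⟩ : Nonempty (ℕ ≃ ℕ × Bool × ℕ) := nonempty_equiv_of_countable
  let N : X → (ℕ → TT) → Prop := fun x q =>
    ∀ k b, x ∈ D.S k b ↔ ∃ i, q (e.symm (k, b, i)) = TT.digit true
  let A : Set (ℕ → TT) := {q | q ∈ twoOmega ∧ ∃ x, N x q}
  have hg : ∀ a : A, ∃ x, N x a := fun a => a.2.2
  choose γ hγ using hg
  have huniq : ∀ (a : A) y, N y a → γ a = y := by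
    intro a y hy
    refine aux_sep D _ _ fun k b => ?_
    rw [hγ a k b, hy k b]
  have hc : Continuous γ := by
    refine aux_cont D γ fun k b => ?_
    have : γ ⁻¹' D.S k b =
        ⋃ i, Subtype.val ⁻¹' {p : ℕ → TT | p (e.symm (k, b, i)) = TT.digit true} := by
      ext a
      simp only [mem_preimage, mem_iUnion, mem_setOf_eq]
      exact hγ a k b
    rw [this]
    exact isOpen_iUnion fun i => (aux_openP _ _).preimage continuous_subtype_val
  obtain ⟨f, hf, hfm, hfe⟩ := H A (fun q hq => hq.1) γ hc
  let P : X → ℕ → Prop := fun y m => y ∈ D.S (e m).1 (e m).2.1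
  let q : ℕ → TT := fun m => TT.digit (decide (P x m))
  have hq : q ∈ A := by
    refine ⟨fun k => by simp [q], x, fun k b => ?_⟩
    simp [q, P]
  have hbot := (hfm ⟨q, hq⟩).2 n
  obtain ⟨b, hb⟩ : ∃ b, f ⟨q, hq⟩ n = TT.digit b := by
    cases h : f ⟨q, hq⟩ n with
    | bot => exact absurd h hbot
    | digit b => exact ⟨b, rfl⟩
  refine ⟨b, ?_⟩
  obtain ⟨W, hW, hWe⟩ := (aux_openP n b).preimage hf
  have hqW : q ∈ W := by
    have : (⟨q, hq⟩ : A) ∈ Subtype.val ⁻¹' W := by rw [hWe]; exact hb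
    exact this
  obtain ⟨I, u, hu, hIu⟩ := isOpen_pi_iff.1 hW q hqW
  let U : Set X := ⋂ m ∈ I.filter (P x), D.S (e m).1 (e m).2.1
  have hU : IsOpen U := isOpen_biInter_finset fun m _ => aux_openS _ _ _
  have hxU : x ∈ U := by
    simp only [U, mem_iInter, Finset.mem_filter]
    exact fun m hm => hm.2
  rw [D.regOpen]
  refine mem_interior.2 ⟨U, ?_, hU, hxU⟩
  intro y hy
  simp only [U, mem_iInter, Finset.mem_filter] at hy
  let q' : ℕ → TT := fun m => if m ∈ I then q m else TT.digit (decide (P y m))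
  have hN : N y q' := by
    intro k c
    constructor
    · intro h
      have hinf : ∃ i, e.symm (k, c, i) ∉ I := by
        by_contra! hcon
        have hinj : Function.Injective fun i : ℕ => e.symm (k, c, i) := by
          intro i j hij
          simpa using hij
        exact Set.infinite_univ (α := ℕ) ((I.finite_toSet.preimage hinj.injOn).subset
          (fun i _ => hcon i))
      obtain ⟨i, hi⟩ := hinf
      refine ⟨i, ?_⟩
      simp [q', hi, P, h]
    · rintro ⟨i, hi⟩
      by_cases hm : e.symm (k, c, i) ∈ I
      · simp only [q', hm, if_true, q, TT.digit.injEq, decide_eq_true_eq] at hi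
        simpa using hy _ ⟨hm, hi⟩
      · simpa [q', hm, P] using hi
  have hq' : q' ∈ A := by
    refine ⟨fun k => ?_, y, hN⟩
    by_cases hk : k ∈ I <;> simp [q', q, hk]
  have hq'W : q' ∈ W := by
    apply hIu
    intro m hm
    have hm' : m ∈ I := hm
    simp only [q', hm', if_true]
    exact (hu m hm').2
  have hfq : f ⟨q', hq'⟩ n = TT.digit b := by
    have : (⟨q', hq'⟩ : A) ∈ Subtype.val ⁻¹' W := hq'W
    rw [hWe] at this
    exact this
  have h1 : ρ (f ⟨q', hq'⟩) ∈ SbarInt D (f ⟨q', hq'⟩) := by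
    rw [hρ _ (hfm _).1]; rfl
  rw [← hfe, huniq ⟨q', hq'⟩ y hN] at h1
  exact h1 n b hfq

/-- Proposition 3.2: ρ'_S (the restriction of ρ_S to ↑X̃ ∩ 2^ω), which is a
surjection onto X, is an admissible representation of X iff S_{n,⊥} = ∅ for every n. -/
theorem stmt_5 {X : Type*} [TopologicalSpace X] [T2Space X] [SecondCountableTopology X]
    (D : DyadicSubbase X) (hD : IsProperDS D)
    (ρ : (ℕ → TT) → X) (hρ : ∀ p ∈ upX D, SbarInt D p = {ρ p}) :
    ((∀ x : X, ∃ p ∈ upX D ∩ twoOmega, ρ p = x) ∧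
      ContinuousOn ρ (upX D ∩ twoOmega) ∧
      ∀ A : Set (ℕ → TT), A ⊆ twoOmega → ∀ γ : A → X, Continuous γ →
        ∃ f : A → (ℕ → TT), Continuous f ∧ (∀ a, f a ∈ upX D ∩ twoOmega) ∧
          ∀ a, γ a = ρ (f a)) ↔
    ∀ n, D.S n false ∪ D.S n true = Set.univ := by
  constructor
  · rintro ⟨-, -, H⟩ n
    refine Set.eq_univ_of_forall fun x => ?_
    obtain ⟨b, hb⟩ := aux_fwd D ρ hρ H n x
    cases b
    · exact Or.inl hb
    · exact Or.inr hb
  · intro h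
    have hup : ∀ x, phi D x ∈ upX D := fun x => ⟨x, fun _ _ h => h⟩
    have htw : ∀ x, phi D x ∈ twoOmega := by
      intro x k hk
      have hx : x ∈ D.S k false ∪ D.S k true := by rw [h k]; trivial
      rcases hx with hx | hx <;> rw [← aux_phi, hk] at hx <;> cases hx
    have hr : ∀ x, ρ (phi D x) = x := by
      intro x
      have : x ∈ SbarInt D (phi D x) := fun k b hb =>
        subset_closure ((aux_phi D x k b).1 hb)
      rw [hρ _ (hup x)] at this
      exact this.symm
    have heq : ∀ p ∈ upX D ∩ twoOmega, ∃ x, p = phi D x := by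
      rintro p ⟨⟨x, hx⟩, -⟩
      refine ⟨x, funext fun k => ?_⟩
      cases hk : phi D x k with
      | bot => exact absurd hk (htw x k)
      | digit b => exact hx k b hk
    refine ⟨fun x => ⟨phi D x, ⟨hup x, htw x⟩, hr x⟩, ?_, ?_⟩
    · rw [continuousOn_iff_continuous_restrict]
      refine aux_cont D _ fun k b => ?_
      convert (aux_openP k b).preimage (continuous_subtype_val (p := (· ∈ upX D ∩ twoOmega)))
        using 1
      ext ⟨p, hp⟩
      obtain ⟨x, rfl⟩ := heq p hp
      simp [hr, aux_phi]
    · intro A _ γ hγ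
      exact ⟨fun a => phi D (γ a), (aux_cont_phi D).comp hγ,
        fun a => ⟨hup _, htw _⟩, fun a => (hr _).symm⟩
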